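/- Contraposition is admissible in SC_TML: if the sequent Γ ⇒ Δ is derivable in SC_TML, then the sequent ¬Δ ⇒ ¬Γ is derivable in SC_TML, where ¬X denotes {¬x : x ∈ X}. -/

import Mathlib

/-- Formulas built from propositional variables by the connectives `∧`, `∨`, `¬`, `□`
(no `⊥`). -/
inductive Formula : Type where
  | var : ℕ → Formula
  | and : Formula → Formula → Formula
  | or : Formula → Formula → Formula
  | neg : Formula → Formula
  | box : Formula → Formula
deriving DecidableEq
/-- The two-sided sequent calculus `SC_TML`.  `SCder c Γ Δ` means the sequent `Γ ⇒ Δ`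
has a derivation; when `c = false` the cut rule is not allowed (cut-free derivability),
`SCder true` is plain derivability. -/
inductive SCder : Bool → Finset Formula → Finset Formula → Prop where
  | ax (c : Bool) (α : Formula) : SCder c {α} {α}
  | weakL {c Γ Δ} (α : Formula) : SCder c Γ Δ → SCder c (insert α Γ) Δ
  | weakR {c Γ Δ} (α : Formula) : SCder c Γ Δ → SCder c Γ (insert α Δ)
  | cut {Γ Δ : Finset Formula} {α : Formula} :
      SCder true Γ (insert α Δ) → SCder true (insert α Γ) Δ → SCder true Γ Δ
  | andL {c Γ Δ} (α β : Formula) :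
      SCder c (insert α (insert β Γ)) Δ → SCder c (insert (α.and β) Γ) Δ
  | andR {c Γ Δ} (α β : Formula) :
      SCder c Γ (insert α Δ) → SCder c Γ (insert β Δ) → SCder c Γ (insert (α.and β) Δ)
  | nandL {c Γ Δ} (α β : Formula) :
      SCder c (insert α.neg Γ) Δ → SCder c (insert β.neg Γ) Δ →
      SCder c (insert (α.and β).neg Γ) Δ
  | nandR {c Γ Δ} (α β : Formula) :
      SCder c Γ (insert α.neg (insert β.neg Δ)) → SCder c Γ (insert (α.and β).neg Δ)
  | orL {c Γ Δ} (α β : Formula) :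
      SCder c (insert α Γ) Δ → SCder c (insert β Γ) Δ → SCder c (insert (α.or β) Γ) Δ
  | orR {c Γ Δ} (α β : Formula) :
      SCder c Γ (insert α (insert β Δ)) → SCder c Γ (insert (α.or β) Δ)
  | norL {c Γ Δ} (α β : Formula) :
      SCder c (insert α.neg (insert β.neg Γ)) Δ → SCder c (insert (α.or β).neg Γ) Δ
  | norR {c Γ Δ} (α β : Formula) :
      SCder c Γ (insert α.neg Δ) → SCder c Γ (insert β.neg Δ) →
      SCder c Γ (insert (α.or β).neg Δ)
  | nnL {c Γ Δ} (α : Formula) : SCder c (insert α Γ) Δ → SCder c (insert α.neg.neg Γ) Δ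
  | nnR {c Γ Δ} (α : Formula) : SCder c Γ (insert α Δ) → SCder c Γ (insert α.neg.neg Δ)
  | boxL1 {c Γ Δ} (α : Formula) : SCder c (insert α Γ) Δ → SCder c (insert α.box Γ) Δ
  | boxL2 {c Γ Δ} (α : Formula) : SCder c Γ (insert α.neg Δ) → SCder c (insert α.box Γ) Δ
  | boxR {c Γ Δ} (α : Formula) :
      SCder c Γ (insert α Δ) → SCder c (insert α.neg Γ) Δ → SCder c Γ (insert α.box Δ)
  | nboxL {c Γ Δ} (α : Formula) :
      SCder c Γ (insert α Δ) → SCder c (insert α.neg Γ) Δ → SCder c (insert α.box.neg Γ) Δ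
  | nboxR1 {c Γ Δ} (α : Formula) : SCder c (insert α Γ) Δ → SCder c Γ (insert α.box.neg Δ)
  | nboxR2 {c Γ Δ} (α : Formula) : SCder c Γ (insert α.neg Δ) → SCder c Γ (insert α.box.neg Δ)

namespace SCder

theorem weaken {c : Bool} {Γ Δ Γ' Δ' : Finset Formula} (h : SCder c Γ Δ)
    (hΓ : Γ ⊆ Γ') (hΔ : Δ ⊆ Δ') : SCder c Γ' Δ' := by
  have left : ∀ S : Finset Formula, SCder c (S ∪ Γ) Δ := fun S => by
    induction S using Finset.induction_on with
    | empty => simpa using h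
    | insert a S _ ih => rw [Finset.insert_union]; exact ih.weakL a
  have right : ∀ S : Finset Formula, SCder c (Γ' ∪ Γ) (S ∪ Δ) := fun S => by
    induction S using Finset.induction_on with
    | empty => simpa using left Γ'
    | insert a S _ ih => rw [Finset.insert_union]; exact ih.weakR a
  simpa [Finset.union_eq_left.2 hΓ, Finset.union_eq_left.2 hΔ] using right Δ'

theorem ax_insert (c : Bool) (α : Formula) (Γ Δ : Finset Formula) :
    SCder c (insert α Γ) (insert α Δ) :=
  (ax c α).weaken (by simp) (by simp)

theorem of_neg_neg_right {Γ Δ : Finset Formula} {α : Formula}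
    (h : SCder true Γ (insert α.neg.neg Δ)) : SCder true Γ (insert α Δ) := by
  refine cut (α := α.neg.neg) ?_ (nnL α (ax_insert _ _ _ _))
  rw [Finset.insert_comm]
  exact h.weakR α

theorem of_neg_neg_left {Γ Δ : Finset Formula} {α : Formula}
    (h : SCder true (insert α.neg.neg Γ) Δ) : SCder true (insert α Γ) Δ := by
  refine cut (α := α.neg.neg) (nnR α (ax_insert _ _ _ _)) ?_
  rw [Finset.insert_comm]
  exact h.weakL α

theorem contrapose {c : Bool} {Γ Δ : Finset Formula} (h : SCder c Γ Δ) :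
    SCder true (Δ.image Formula.neg) (Γ.image Formula.neg) := by
  induction h with
  | ax c α => simpa using ax true α.neg
  | weakL α _ ih => simpa using ih.weakR α.neg
  | weakR α _ ih => simpa using ih.weakL α.neg
  | cut _ _ ih₁ ih₂ =>
    rw [Finset.image_insert] at ih₁ ih₂
    exact cut ih₂ ih₁
  | andL α β _ ih =>
    simp only [Finset.image_insert] at ih ⊢
    exact nandR α β ih
  | andR α β _ _ ih₁ ih₂ =>
    simp only [Finset.image_insert] at ih₁ ih₂ ⊢
    exact nandL α β ih₁ ih₂
  | nandL α β _ _ ih₁ ih₂ =>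
    simp only [Finset.image_insert] at ih₁ ih₂ ⊢
    exact nnR _ (andR α β ih₁.of_neg_neg_right ih₂.of_neg_neg_right)
  | nandR α β _ ih =>
    simp only [Finset.image_insert] at ih ⊢
    have h := ih.of_neg_neg_left
    rw [Finset.insert_comm] at h
    have h := h.of_neg_neg_left
    rw [Finset.insert_comm] at h
    exact nnL _ (andL α β h)
  | orL α β _ _ ih₁ ih₂ =>
    simp only [Finset.image_insert] at ih₁ ih₂ ⊢
    exact norR α β ih₁ ih₂
  | orR α β _ ih =>
    simp only [Finset.image_insert] at ih ⊢
    exact norL α β ih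
  | norL α β _ ih =>
    simp only [Finset.image_insert] at ih ⊢
    have h := ih.of_neg_neg_right
    rw [Finset.insert_comm] at h
    have h := h.of_neg_neg_right
    rw [Finset.insert_comm] at h
    exact nnR _ (orR α β h)
  | norR α β _ _ ih₁ ih₂ =>
    simp only [Finset.image_insert] at ih₁ ih₂ ⊢
    exact nnL _ (orL α β ih₁.of_neg_neg_left ih₂.of_neg_neg_left)
  | nnL α _ ih =>
    simp only [Finset.image_insert] at ih ⊢
    exact nnR _ ih
  | nnR α _ ih =>
    simp only [Finset.image_insert] at ih ⊢
    exact nnL _ ih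
  | boxL1 α _ ih =>
    simp only [Finset.image_insert] at ih ⊢
    exact nboxR2 α ih
  | boxL2 α _ ih =>
    simp only [Finset.image_insert] at ih ⊢
    exact nboxR1 α ih.of_neg_neg_left
  | boxR α _ _ ih₁ ih₂ =>
    simp only [Finset.image_insert] at ih₁ ih₂ ⊢
    exact nboxL α ih₂.of_neg_neg_right ih₁
  | nboxL α _ _ ih₁ ih₂ =>
    simp only [Finset.image_insert] at ih₁ ih₂ ⊢
    exact nnR _ (boxR α ih₂.of_neg_neg_right ih₁)
  | nboxR1 α _ ih =>
    simp only [Finset.image_insert] at ih ⊢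
    exact nnL _ (boxL2 α ih)
  | nboxR2 α _ ih =>
    simp only [Finset.image_insert] at ih ⊢
    exact nnL _ (boxL1 α ih.of_neg_neg_left)

end SCder

/-- Contraposition is admissible in `SC_TML`. -/
theorem sc_contraposition (Γ Δ : Finset Formula) (h : SCder true Γ Δ) :
    SCder true (Δ.image Formula.neg) (Γ.image Formula.neg) := by
  exact h.contrapose
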